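/- For θ, H ∈ Θ and γ > 0 set S_γ(θ) = Prox_γ(θ − γH) and η = H − ∇f(θ). Then: (i) for every γ > 0, ‖T_γ(θ) − S_γ(θ)‖ ≤ γ ‖η‖; (ii) for every γ ∈ (0, 1/L], |F(S_γ(θ)) − F(T_γ(θ))| ≤ (1 + c γ L) ‖η‖ (γ ‖η‖ + (1 + c γ L) ‖θ − T_γ(θ)‖), where c = 0 if f is convex and c = 1 in general. -/

import Mathlib

open Filter MeasureTheory Finset
open scoped InnerProductSpace Topology

noncomputable section

variable {E : Type*} [NormedAddCommGroup E] [InnerProductSpace ℝ E]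

/-- Convexity of an `EReal`-valued function `g` (codomain `(-∞, +∞]`). -/
def ERealConvexOn (g : E → EReal) : Prop :=
  ∀ x y : E, ∀ a b : ℝ, 0 ≤ a → 0 ≤ b → a + b = 1 →
    g (a • x + b • y) ≤ (a : EReal) * g x + (b : EReal) * g y

/-- `p` minimizes `v ↦ g v + ‖v - θ‖² / (2γ)`. -/
def IsProxPt (g : E → EReal) (γ : ℝ) (θ p : E) : Prop :=
  ∀ v : E, g p + ((‖p - θ‖ ^ 2 / (2 * γ) : ℝ) : EReal)
      ≤ g v + ((‖v - θ‖ ^ 2 / (2 * γ) : ℝ) : EReal)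

/-- Subdifferential of an `EReal`-valued convex function at `θ`. -/
def subdiff (g : E → EReal) (θ : E) : Set E :=
  {u : E | ∀ v : E, g θ + ((⟪u, v - θ⟫_ℝ : ℝ) : EReal) ≤ g v}

/-- The set `𝓛 = {θ ∈ Dom g : 0 ∈ ∇f(θ) + ∂g(θ)}`. -/
def statPoints (f' : E → E) (g : E → EReal) : Set E :=
  {θ : E | g θ ≠ ⊤ ∧ -f' θ ∈ subdiff g θ}

/-- `F = f + g`, with values in `(-∞, +∞]`. -/
def Fval (f : E → ℝ) (g : E → EReal) (θ : E) : EReal := (f θ : EReal) + g θ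

/-- The real value of `F = f + g` (used at points of the domain of `g`). -/
def Freal (f : E → ℝ) (g : E → EReal) (θ : E) : ℝ := f θ + (g θ).toReal

/-- The proximal gradient map `T_γ(θ) = Prox_γ(θ - γ ∇f(θ))`. -/
def Tmap (prox : ℝ → E → E) (f' : E → E) (γ : ℝ) (θ : E) : E :=
  prox γ (θ - γ • f' θ)

variable [CompleteSpace E]

/-- Standing assumptions: `g` is convex, lower semicontinuous, proper, with values in
`(-∞, +∞]`; `f` is differentiable with `L`-Lipschitz gradient `f'`; and `prox γ θ`
is the unique minimizer of `v ↦ g v + ‖v - θ‖²/(2γ)` for every `γ > 0`. -/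
structure ProxSetting (f : E → ℝ) (f' : E → E) (g : E → EReal) (L : ℝ)
    (prox : ℝ → E → E) : Prop where
  g_ne_bot : ∀ x, g x ≠ ⊥
  g_ne_top : ∃ x, g x ≠ ⊤
  g_lsc : LowerSemicontinuous g
  g_conv : ERealConvexOn g
  f_grad : ∀ x, HasGradientAt f (f' x) x
  L_pos : 0 < L
  lip : ∀ x y, ‖f' x - f' y‖ ≤ L * ‖x - y‖
  prox_spec : ∀ γ : ℝ, 0 < γ → ∀ θ, IsProxPt g γ θ (prox γ θ)
  prox_unique : ∀ γ : ℝ, 0 < γ → ∀ θ p, IsProxPt g γ θ p → p = prox γ θ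

end


section helpers

variable {E : Type*} [NormedAddCommGroup E] [InnerProductSpace ℝ E]

theorem aux_prox_ineq (g : E → EReal) (hb : ∀ x, g x ≠ ⊥) (hc : ERealConvexOn g)
    (γ : ℝ) (hγ : 0 < γ) (x p v : E) (hp : IsProxPt g γ x p) (hpt : g p ≠ ⊤) (hvt : g v ≠ ⊤) :
    γ * ((g p).toReal - (g v).toReal) ≤ ⟪p - x, v - p⟫_ℝ := by
  obtain ⟨a, ha⟩ : ∃ a : ℝ, g p = (a : EReal) := ⟨_, (EReal.coe_toReal hpt (hb p)).symm⟩
  obtain ⟨b, hbv⟩ : ∃ a : ℝ, g v = (a : EReal) := ⟨_, (EReal.coe_toReal hvt (hb v)).symm⟩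
  rw [ha, hbv, EReal.toReal_coe, EReal.toReal_coe]
  have key : ∀ t : ℝ, 0 < t → t ≤ 1 →
      γ * (a - b) ≤ ⟪p - x, v - p⟫_ℝ + t * (‖v - p‖ ^ 2 / 2) := by
    intro t ht ht1
    have h1 := hp ((1 - t) • p + t • v)
    have h2 := hc p v (1 - t) t (by linarith) ht.le (by ring)
    have h3 := h1.trans (add_le_add_left h2 _)
    rw [ha, hbv] at h3
    norm_cast at h3
    have e : (1 - t) • p + t • v - x = (p - x) + t • (v - p) := by module
    rw [e, norm_add_sq_real, inner_smul_right, norm_smul, Real.norm_eq_abs, mul_pow, sq_abs] at h3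
    have h4 : (2 * γ) * (a + ‖p - x‖ ^ 2 / (2 * γ)) ≤ (2 * γ) * ((1 - t) * a + t * b +
      (‖p - x‖ ^ 2 + 2 * (t * ⟪p - x, v - p⟫_ℝ) + t ^ 2 * ‖v - p‖ ^ 2) / (2 * γ)) :=
      mul_le_mul_of_nonneg_left h3 (by positivity)
    rw [mul_add, mul_add (2 * γ), mul_div_cancel₀ _ (by positivity),
      mul_div_cancel₀ _ (by positivity)] at h4
    have h5 : t * (γ * (a - b)) ≤ t * (⟪p - x, v - p⟫_ℝ + t * (‖v - p‖ ^ 2 / 2)) := by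
      nlinarith
    exact le_of_mul_le_mul_left h5 ht
  have lim : Tendsto (fun t : ℝ => ⟪p - x, v - p⟫_ℝ + t * (‖v - p‖ ^ 2 / 2)) (𝓝[>] 0)
      (𝓝 (⟪p - x, v - p⟫_ℝ)) := by
    have : Continuous (fun t : ℝ => ⟪p - x, v - p⟫_ℝ + t * (‖v - p‖ ^ 2 / 2)) := by fun_prop
    have h := this.tendsto 0
    simp only [zero_mul, add_zero] at h
    exact h.mono_left nhdsWithin_le_nhds
  refine ge_of_tendsto lim ?_
  filter_upwards [Ioc_mem_nhdsGT (zero_lt_one' ℝ)] with t ht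
  exact key t ht.1 ht.2

theorem aux_prox_ne_top (g : E → EReal) (hg : ∃ x, g x ≠ ⊤)
    (γ : ℝ) (x p : E) (hp : IsProxPt g γ x p) : g p ≠ ⊤ := by
  obtain ⟨v, hv⟩ := hg
  intro h
  have h1 := hp v
  rw [h, EReal.top_add_coe, top_le_iff] at h1
  exact EReal.add_ne_top hv (EReal.coe_ne_top _) h1

variable [CompleteSpace E]

theorem aux_descent (f : E → ℝ) (f' : E → E) (L : ℝ) (hf : ∀ x, HasGradientAt f (f' x) x)
    (lip : ∀ x y, ‖f' x - f' y‖ ≤ L * ‖x - y‖) (x y : E) :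
    f y ≤ f x + ⟪f' x, y - x⟫_ℝ + L / 2 * ‖y - x‖ ^ 2 := by
  set u := y - x with hu
  have hd : ∀ t : ℝ, HasDerivAt
      (fun t : ℝ => f (x + t • u) - t * ⟪f' x, u⟫_ℝ - L / 2 * ‖u‖ ^ 2 * t ^ 2)
      (⟪f' (x + t • u), u⟫_ℝ - 1 * ⟪f' x, u⟫_ℝ - L / 2 * ‖u‖ ^ 2 * (2 * t)) t := by
    intro t
    have h1 : HasDerivAt (fun t : ℝ => x + t • u) u t := by
      simpa using ((hasDerivAt_id t).smul_const u).const_add x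
    have h2 : HasDerivAt (fun t : ℝ => f (x + t • u)) ⟪f' (x + t • u), u⟫_ℝ t := by
      simpa [Function.comp_def] using (hf (x + t • u)).hasFDerivAt.comp_hasDerivAt t h1
    have h3 : HasDerivAt (fun t : ℝ => t ^ 2) (2 * t) t := by
      simpa using hasDerivAt_pow 2 t
    have h4 := (h2.sub ((hasDerivAt_id t).mul_const ⟪f' x, u⟫_ℝ)).sub
      (h3.const_mul (L / 2 * ‖u‖ ^ 2))
    exact h4
  have hanti := antitoneOn_of_deriv_nonpos (convex_Icc (0:ℝ) 1)
    (f := fun t : ℝ => f (x + t • u) - t * ⟪f' x, u⟫_ℝ - L / 2 * ‖u‖ ^ 2 * t ^ 2)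
    (fun t _ => (hd t).continuousAt.continuousWithinAt)
    (fun t _ => (hd t).differentiableAt.differentiableWithinAt)
    (by
      intro t ht
      rw [interior_Icc] at ht
      rw [(hd t).deriv]
      have h1 := real_inner_le_norm (f' (x + t • u) - f' x) u
      have h2 := lip (x + t • u) x
      rw [add_sub_cancel_left, norm_smul, Real.norm_eq_abs, abs_of_pos ht.1] at h2
      have h3 := mul_le_mul_of_nonneg_right h2 (norm_nonneg u)
      rw [inner_sub_left] at h1
      nlinarith)
  have h := hanti (Set.left_mem_Icc.2 zero_le_one) (Set.right_mem_Icc.2 zero_le_one) zero_le_one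
  have e : x + u = y := by rw [hu]; abel
  simp [e] at h
  linarith

theorem aux_descent_low (f : E → ℝ) (f' : E → E) (L : ℝ) (hf : ∀ x, HasGradientAt f (f' x) x)
    (lip : ∀ x y, ‖f' x - f' y‖ ≤ L * ‖x - y‖) (x y : E) :
    f x + ⟪f' x, y - x⟫_ℝ - L / 2 * ‖y - x‖ ^ 2 ≤ f y := by
  have h := aux_descent (fun x => - f x) (fun x => - f' x) L
    (fun x => by
      have := (hf x).hasFDerivAt.neg
      rw [hasGradientAt_iff_hasFDerivAt, map_neg]
      exact this)
    (fun x y => by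
      have := lip x y
      rwa [neg_sub_neg, norm_sub_rev]) x y
  simp only [inner_neg_left] at h
  linarith

theorem aux_convex_grad (f : E → ℝ) (f' : E → E) (hf : ∀ x, HasGradientAt f (f' x) x)
    (hc : ConvexOn ℝ Set.univ f) (L : ℝ) (lip : ∀ x y, ‖f' x - f' y‖ ≤ L * ‖x - y‖) (x y : E) :
    f x + ⟪f' x, y - x⟫_ℝ ≤ f y := by
  have key : ∀ t : ℝ, 0 < t → t ≤ 1 →
      f x + ⟪f' x, y - x⟫_ℝ - t * (L / 2 * ‖y - x‖ ^ 2) ≤ f y := by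
    intro t ht ht1
    have h1 := aux_descent_low f f' L hf lip x ((1 - t) • x + t • y)
    have h2 := hc.2 (Set.mem_univ x) (Set.mem_univ y) (sub_nonneg.2 ht1) ht.le (by ring)
    have e : (1 - t) • x + t • y - x = t • (y - x) := by module
    rw [e, inner_smul_right, norm_smul, Real.norm_eq_abs, mul_pow, sq_abs] at h1
    simp only [smul_eq_mul] at h2
    refine le_of_mul_le_mul_left ?_ ht
    nlinarith
  have lim : Tendsto (fun t : ℝ => f x + ⟪f' x, y - x⟫_ℝ - t * (L / 2 * ‖y - x‖ ^ 2)) (𝓝[>] 0)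
      (𝓝 (f x + ⟪f' x, y - x⟫_ℝ)) := by
    have : Continuous (fun t : ℝ => f x + ⟪f' x, y - x⟫_ℝ - t * (L / 2 * ‖y - x‖ ^ 2)) := by
      fun_prop
    have h := this.tendsto 0
    simp only [zero_mul, sub_zero] at h
    exact h.mono_left nhdsWithin_le_nhds
  refine le_of_tendsto lim ?_
  filter_upwards [Ioc_mem_nhdsGT (zero_lt_one' ℝ)] with t ht
  exact key t ht.1 ht.2

theorem aux_coco_half (f : E → ℝ) (f' : E → E) (hf : ∀ x, HasGradientAt f (f' x) x)
    (hc : ConvexOn ℝ Set.univ f) (L : ℝ) (lip : ∀ x y, ‖f' x - f' y‖ ≤ L * ‖x - y‖)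
    (γ : ℝ) (hγ : 0 < γ) (hγL : γ * L ≤ 1) (x y : E) :
    f x + ⟪f' x, y - x⟫_ℝ + γ / 2 * ‖f' y - f' x‖ ^ 2 ≤ f y := by
  set a := f' y - f' x with ha
  have h1 := aux_convex_grad f f' hf hc L lip x (y - γ • a)
  have h2 := aux_descent f f' L hf lip y (y - γ • a)
  have e1 : y - γ • a - x = (y - x) - γ • a := by abel
  have e2 : y - γ • a - y = - (γ • a) := by abel
  rw [e1, inner_sub_right, inner_smul_right] at h1
  rw [e2, inner_neg_right, inner_smul_right, norm_neg, norm_smul, Real.norm_eq_abs, mul_pow,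
    sq_abs] at h2
  have e3 : ⟪f' y, a⟫_ℝ - ⟪f' x, a⟫_ℝ = ‖a‖ ^ 2 := by
    rw [← inner_sub_left, ← ha, real_inner_self_eq_norm_sq]
  have h4 : γ * L * (γ * ‖a‖ ^ 2) ≤ 1 * (γ * ‖a‖ ^ 2) :=
    mul_le_mul_of_nonneg_right hγL (by positivity)
  have h5 : γ * (⟪f' y, a⟫_ℝ - ⟪f' x, a⟫_ℝ) = γ * ‖a‖ ^ 2 := by rw [e3]
  nlinarith

theorem aux_nonexp (f : E → ℝ) (f' : E → E) (hf : ∀ x, HasGradientAt f (f' x) x)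
    (hc : ConvexOn ℝ Set.univ f) (L : ℝ) (lip : ∀ x y, ‖f' x - f' y‖ ≤ L * ‖x - y‖)
    (γ : ℝ) (hγ : 0 < γ) (hγL : γ * L ≤ 1) (x y : E) :
    ‖(x - y) - γ • (f' x - f' y)‖ ≤ ‖x - y‖ := by
  have h1 := aux_coco_half f f' hf hc L lip γ hγ hγL x y
  have h2 := aux_coco_half f f' hf hc L lip γ hγ hγL y x
  rw [← neg_sub x y, inner_neg_right, norm_sub_rev] at h1
  have e : ⟪f' x - f' y, x - y⟫_ℝ = ⟪f' x, x - y⟫_ℝ - ⟪f' y, x - y⟫_ℝ := inner_sub_left _ _ _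
  have h3 : γ * ‖f' x - f' y‖ ^ 2 ≤ ⟪x - y, f' x - f' y⟫_ℝ := by
    rw [real_inner_comm, e]; linarith
  refine (sq_le_sq₀ (norm_nonneg _) (norm_nonneg _)).1 ?_
  rw [norm_sub_sq_real, inner_smul_right, norm_smul, Real.norm_eq_abs, mul_pow, sq_abs]
  have h4 := mul_le_mul_of_nonneg_left h3 hγ.le
  have h5 : 0 ≤ γ * (γ * ‖f' x - f' y‖ ^ 2) := by positivity
  nlinarith

theorem aux_first (f : E → ℝ) (f' : E → E) (g : E → EReal) (L : ℝ) (prox : ℝ → E → E)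
    (hs : ProxSetting f f' g L prox) (γ : ℝ) (hγ : 0 < γ) (x y : E) :
    ‖prox γ x - prox γ y‖ ≤ ‖x - y‖ := by
  have hx := hs.prox_spec γ hγ x
  have hy := hs.prox_spec γ hγ y
  have tx := aux_prox_ne_top g hs.g_ne_top γ _ _ hx
  have ty := aux_prox_ne_top g hs.g_ne_top γ _ _ hy
  have h1 := aux_prox_ineq g hs.g_ne_bot hs.g_conv γ hγ _ _ _ hx tx ty
  have h2 := aux_prox_ineq g hs.g_ne_bot hs.g_conv γ hγ _ _ _ hy ty tx
  generalize prox γ x = p at *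
  generalize prox γ y = q at *
  have h3 : ‖p - q‖ ^ 2 ≤ ⟪x - y, p - q⟫_ℝ := by
    have e : ⟪p - x, q - p⟫_ℝ + ⟪q - y, p - q⟫_ℝ = ⟪x - y, p - q⟫_ℝ - ‖p - q‖ ^ 2 := by
      rw [← real_inner_self_eq_norm_sq, ← inner_sub_left, ← neg_sub p q, inner_neg_right,
        ← inner_neg_left, ← inner_add_left]
      congr 1
      abel
    linarith
  have h4 := h3.trans (real_inner_le_norm _ _)
  by_contra! h
  nlinarith [norm_nonneg (x - y), norm_nonneg (p - q)]

theorem aux_second (f : E → ℝ) (f' : E → E) (g : E → EReal) (L : ℝ) (prox : ℝ → E → E)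
    (hs : ProxSetting f f' g L prox) (γ : ℝ) (hγ : 0 < γ) (hγL : γ * L ≤ 1) (θ H : E) (K : ℝ)
    (hK : ‖(θ - Tmap prox f' γ θ) - γ • (f' θ - f' (Tmap prox f' γ θ))‖
      ≤ K * ‖θ - Tmap prox f' γ θ‖) :
    |Freal f g (prox γ (θ - γ • H)) - Freal f g (Tmap prox f' γ θ)| ≤
              ‖H - f' θ‖ * (γ * ‖H - f' θ‖ + K * ‖θ - Tmap prox f' γ θ‖) := by
  have hd := aux_first f f' g L prox hs γ hγ (θ - γ • H) (θ - γ • f' θ)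
  have e0 : θ - γ • H - (θ - γ • f' θ) = - (γ • (H - f' θ)) := by module
  rw [e0, norm_neg, norm_smul, Real.norm_eq_abs, abs_of_pos hγ] at hd
  have hx := hs.prox_spec γ hγ (θ - γ • H)
  have hy := hs.prox_spec γ hγ (θ - γ • f' θ)
  have tx := aux_prox_ne_top g hs.g_ne_top γ _ _ hx
  have ty := aux_prox_ne_top g hs.g_ne_top γ _ _ hy
  have h1 := aux_prox_ineq g hs.g_ne_bot hs.g_conv γ hγ _ _ _ hx tx ty
  have h2 := aux_prox_ineq g hs.g_ne_bot hs.g_conv γ hγ _ _ _ hy ty tx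
  unfold Freal
  unfold Tmap at *
  generalize prox γ (θ - γ • H) = S at *
  generalize prox γ (θ - γ • f' θ) = T at *
  have h3 := aux_descent f f' L hs.f_grad hs.lip T S
  have h4 := aux_descent_low f f' L hs.f_grad hs.lip T S
  generalize (g S).toReal = gS at *
  generalize (g T).toReal = gT at *
  set X := (θ - T) - γ • (f' θ - f' T) with hX
  have hXd : |⟪X, S - T⟫_ℝ| ≤ K * ‖θ - T‖ * (γ * ‖H - f' θ‖) :=
    (abs_real_inner_le_norm _ _).trans
      (mul_le_mul hK hd (norm_nonneg _) ((norm_nonneg _).trans hK))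
  have hηd := abs_real_inner_le_norm (H - f' θ) (S - T)
  have e1 : ⟪S - (θ - γ • H), T - S⟫_ℝ =
      ⟪X, S - T⟫_ℝ - γ * ⟪f' T, S - T⟫_ℝ - ‖S - T‖ ^ 2 - γ * ⟪H - f' θ, S - T⟫_ℝ := by
    rw [← real_inner_self_eq_norm_sq, ← real_inner_smul_left, ← real_inner_smul_left,
      ← inner_sub_left, ← inner_sub_left, ← inner_sub_left, ← neg_sub S T, inner_neg_right,
      ← inner_neg_left]
    congr 1
    rw [hX]
    module
  have e2 : ⟪T - (θ - γ • f' θ), S - T⟫_ℝ = γ * ⟪f' T, S - T⟫_ℝ - ⟪X, S - T⟫_ℝ := by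
    rw [← real_inner_smul_left, ← inner_sub_left]
    congr 1
    rw [hX]
    module
  rw [e1] at h1
  rw [e2] at h2
  have hq : γ * L * ‖S - T‖ ^ 2 ≤ 1 * ‖S - T‖ ^ 2 :=
    mul_le_mul_of_nonneg_right hγL (by positivity)
  have h3' := mul_le_mul_of_nonneg_left h3 hγ.le
  have h4' := mul_le_mul_of_nonneg_left h4 hγ.le
  have hn := norm_nonneg (S - T)
  have hm := mul_le_mul_of_nonneg_left hd (norm_nonneg (H - f' θ))
  have hm2 := mul_le_mul_of_nonneg_left (hηd.trans hm) hγ.le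
  have hsq : ‖S - T‖ ^ 2 ≤ (γ * ‖H - f' θ‖) ^ 2 := pow_le_pow_left₀ hn hd 2
  have hηa := mul_le_mul_of_nonneg_left (neg_abs_le ⟪H - f' θ, S - T⟫_ℝ) hγ.le
  rw [abs_le] at hXd
  rw [abs_le]
  constructor
  · refine le_of_mul_le_mul_left ?_ hγ
    nlinarith [hXd.1, hXd.2]
  · refine le_of_mul_le_mul_left ?_ hγ
    nlinarith [hXd.1, hXd.2]

end helpers

/-- **Lemma 6.4** (perturbation bounds). -/
theorem stmt16
    {E : Type*} [NormedAddCommGroup E] [InnerProductSpace ℝ E] [FiniteDimensional ℝ E]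
    (f : E → ℝ) (f' : E → E) (g : E → EReal) (L : ℝ) (prox : ℝ → E → E)
    (hs : ProxSetting f f' g L prox)
 :
    (∀ γ : ℝ, 0 < γ → ∀ θ H : E,
        ‖Tmap prox f' γ θ - prox γ (θ - γ • H)‖ ≤ γ * ‖H - f' θ‖) ∧
      (∀ γ : ℝ, 0 < γ → γ ≤ 1 / L → ∀ θ H : E,
        (|Freal f g (prox γ (θ - γ • H)) - Freal f g (Tmap prox f' γ θ)| ≤
            (1 + γ * L) * ‖H - f' θ‖ *
              (γ * ‖H - f' θ‖ + (1 + γ * L) * ‖θ - Tmap prox f' γ θ‖)) ∧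
          (ConvexOn ℝ Set.univ f →
            |Freal f g (prox γ (θ - γ • H)) - Freal f g (Tmap prox f' γ θ)| ≤
              ‖H - f' θ‖ * (γ * ‖H - f' θ‖ + ‖θ - Tmap prox f' γ θ‖))) := by
  refine ⟨?_, ?_⟩
  · intro γ hγ θ H
    have h := aux_first f f' g L prox hs γ hγ (θ - γ • f' θ) (θ - γ • H)
    have e : θ - γ • f' θ - (θ - γ • H) = γ • (H - f' θ) := by module
    rwa [e, norm_smul, Real.norm_eq_abs, abs_of_pos hγ] at h
  · intro γ hγ hγL θ H
    have hL : γ * L ≤ 1 := (le_div_iff₀ hs.L_pos).1 hγL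
    have hp : 0 ≤ γ * L := mul_nonneg hγ.le hs.L_pos.le
    refine ⟨?_, ?_⟩
    · have h := aux_second f f' g L prox hs γ hγ hL θ H (1 + γ * L) (by
        refine (norm_sub_le _ _).trans ?_
        rw [norm_smul, Real.norm_eq_abs, abs_of_pos hγ]
        have := mul_le_mul_of_nonneg_left (hs.lip θ (Tmap prox f' γ θ)) hγ.le
        linarith)
      have h5 : 0 ≤ ‖H - f' θ‖ * (γ * ‖H - f' θ‖ + (1 + γ * L) * ‖θ - Tmap prox f' γ θ‖) := by
        positivity
      have h6 := mul_nonneg hp h5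
      linarith
    · intro hc
      have h := aux_second f f' g L prox hs γ hγ hL θ H 1 (by
        rw [one_mul]
        exact aux_nonexp f f' hs.f_grad hc L hs.lip γ hγ hL _ _)
      rwa [one_mul] at h
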